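/- arXiv:2003.03437 — 8 statements merged into one kernel-verified Lean document; each statement's English description precedes it below -/
import Mathlib

section
/- Let n ≥ 1, let f : ℝ^n → ℝ, let μ > 0, ε ≥ 0, and x ∈ ℝ^n. Let m : ℝ^n → ℝ be convex with m(z) ≤ f(z) for all z ∈ ℝ^n, and suppose p ∈ ℝ^n is a minimizer over z ∈ ℝ^n of z ↦ m(z) + (μ/2)‖z − x‖², and that f(p) − m(p) ≤ ε. Then μ(x − p) is an ε-subgradient of f at p, i.e. for every z ∈ ℝ^n, f(z) ≥ f(p) + μ⟨x − p, z − p⟩ − ε. -/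
open RealInnerProductSpace

/-- A minimizer `p` of `m + μ / 2 * ‖· - x‖ ^ 2`, with `m` convex, is a proximal point:
`μ • (x - p)` is a subgradient of `m` at `p`. -/
theorem ConvexOn.add_inner_le_of_prox_minimizer {E : Type*} [NormedAddCommGroup E]
    [InnerProductSpace ℝ E] {m : E → ℝ} (hm : ConvexOn ℝ Set.univ m) {μ : ℝ} (hμ : 0 ≤ μ)
    {x p : E} (hp : ∀ z, m p + μ / 2 * ‖p - x‖ ^ 2 ≤ m z + μ / 2 * ‖z - x‖ ^ 2) (z : E) :
    m p + μ * ⟪x - p, z - p⟫ ≤ m z := by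
  have key : ∀ t : ℝ, 0 < t → t ≤ 1 →
      0 ≤ m z - m p - μ * ⟪x - p, z - p⟫ + μ / 2 * t * ‖z - p‖ ^ 2 := by
    intro t ht0 ht1
    have hconv := hm.2 (Set.mem_univ p) (Set.mem_univ z) (sub_nonneg.2 ht1) ht0.le
      (sub_add_cancel 1 t)
    have hmin := hp ((1 - t) • p + t • z)
    have hnorm : ‖(1 - t) • p + t • z - x‖ ^ 2
        = ‖p - x‖ ^ 2 - 2 * t * ⟪x - p, z - p⟫ + t ^ 2 * ‖z - p‖ ^ 2 := by
      have hsplit : (1 - t) • p + t • z - x = t • (z - p) - (x - p) := by module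
      rw [hsplit, norm_sub_sq_real, real_inner_smul_left, norm_smul, mul_pow,
        Real.norm_eq_abs, sq_abs, real_inner_comm, norm_sub_rev p x]
      ring
    rw [hnorm] at hmin
    simp only [smul_eq_mul] at hconv
    refine nonneg_of_mul_nonneg_right (a := t) ?_ ht0
    linarith
  by_contra! hlt
  set a := m p + μ * ⟪x - p, z - p⟫ - m z with ha
  have ha0 : 0 < a := sub_pos.2 hlt
  have hd : 0 ≤ μ * ‖z - p‖ ^ 2 := by positivity
  have hs : 0 < a + μ * ‖z - p‖ ^ 2 := by linarith
  have ht := key (a / (a + μ * ‖z - p‖ ^ 2)) (by positivity) ((div_le_one hs).2 (by linarith))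
  have hle : a / (a + μ * ‖z - p‖ ^ 2) * (μ * ‖z - p‖ ^ 2) ≤ a := by
    rw [div_mul_eq_mul_div, div_le_iff₀ hs]
    nlinarith
  linarith

theorem stmt_3 (n : ℕ) (hn : 1 ≤ n) (f : EuclideanSpace ℝ (Fin n) → ℝ)
    (μ ε : ℝ) (hμ : 0 < μ) (hε : 0 ≤ ε) (x : EuclideanSpace ℝ (Fin n))
    (m : EuclideanSpace ℝ (Fin n) → ℝ) (hmconv : ConvexOn ℝ Set.univ m)
    (hm : ∀ z, m z ≤ f z)
    (p : EuclideanSpace ℝ (Fin n))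
    (hp : ∀ z, m p + μ / 2 * ‖p - x‖ ^ 2 ≤ m z + μ / 2 * ‖z - x‖ ^ 2)
    (hgap : f p - m p ≤ ε) :
    ∀ z : EuclideanSpace ℝ (Fin n), f z ≥ f p + μ * ⟪x - p, z - p⟫ - ε := by
  intro z
  have hsub := hmconv.add_inner_le_of_prox_minimizer hμ.le hp z
  linarith [hm z]
end

section
/- Let E be a real inner product space, f : E → ℝ, μ > 0, and x* ∈ E. Let (λ_k)_{k ≥ 0} be real numbers with λ_k ≥ 1 for all k and λ_{k−1}² = λ_k(λ_k − 1) for all k ≥ 1. Let (x_k), (y_k) be sequences in E and (ε_k) nonnegative reals satisfying the inexact proximal condition: for every k ≥ 0 and every z ∈ E, f(z) ≥ f(y_{k+1}) + μ⟨x_k − y_{k+1}, z − y_{k+1}⟩ − ε_k. Set δ_k = f(y_k) − f(x*), u_k = λ_k(y_{k+1} − x_k), and v_k = λ_k(y_{k+1} − y_k) + y_k − x*. Then for every k ≥ 1, λ_{k−1}² δ_k − λ_k² δ_{k+1} ≥ μ⟨u_k, v_k⟩ − λ_k² ε_k. -/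
open RealInnerProductSpace

theorem stmt_5 {E : Type*} [NormedAddCommGroup E] [InnerProductSpace ℝ E]
    (f : E → ℝ) (μ : ℝ) (hμ : 0 < μ) (xstar : E)
    (lam : ℕ → ℝ) (hlam1 : ∀ k, 1 ≤ lam k)
    (hlamrec : ∀ k : ℕ, 1 ≤ k → lam (k - 1) ^ 2 = lam k * (lam k - 1))
    (x y : ℕ → E) (eps : ℕ → ℝ) (heps : ∀ k, 0 ≤ eps k)
    (hsub : ∀ k : ℕ, ∀ z : E,
      f z ≥ f (y (k + 1)) + μ * ⟪x k - y (k + 1), z - y (k + 1)⟫ - eps k) :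
    ∀ k : ℕ, 1 ≤ k →
      lam (k - 1) ^ 2 * (f (y k) - f xstar) - lam k ^ 2 * (f (y (k + 1)) - f xstar) ≥
        μ * ⟪lam k • (y (k + 1) - x k), lam k • (y (k + 1) - y k) + y k - xstar⟫ -
          lam k ^ 2 * eps k := by
  intro k hk
  have hl := hlam1 k
  have hy := mul_le_mul_of_nonneg_left (hsub k (y k))
    (mul_nonneg (by linarith) (by linarith) : 0 ≤ lam k * (lam k - 1))
  have hx := mul_le_mul_of_nonneg_left (hsub k xstar) (by linarith : 0 ≤ lam k)
  have hinner : ⟪lam k • (y (k + 1) - x k), lam k • (y (k + 1) - y k) + y k - xstar⟫ =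
      lam k * (lam k - 1) * ⟪x k - y (k + 1), y k - y (k + 1)⟫ +
        lam k * ⟪x k - y (k + 1), xstar - y (k + 1)⟫ := by
    simp only [inner_sub_left, inner_sub_right, inner_add_right, real_inner_smul_left,
      real_inner_smul_right]
    ring
  rw [hlamrec k hk, hinner]
  linarith
end

section
/- Let E be a real inner product space, f : E → ℝ, μ > 0, and x* ∈ E. Let (λ_k)_{k ≥ 0} be real numbers with λ_k ≥ 1 for all k and λ_{k−1}² = λ_k(λ_k − 1) for all k ≥ 1. Let (x_k), (y_k) be sequences in E and (ε_k) nonnegative reals satisfying: (i) for every k ≥ 0 and every z ∈ E, f(z) ≥ f(y_{k+1}) + μ⟨x_k − y_{k+1}, z − y_{k+1}⟩ − ε_k; (ii) the FPBA1 update x_{k+1} = y_{k+1} + ((λ_k − 1)/λ_{k+1})(y_{k+1} − y_k) for all k ≥ 0. Set δ_k = f(y_k) − f(x*) and w_k = λ_k(x_k − y_k) + y_k − x*. Then for every k ≥ 1, λ_{k−1}² δ_k − λ_k² δ_{k+1} ≥ (μ/2)‖w_{k+1}‖² − (μ/2)‖w_k‖² − λ_k² ε_k. -/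
open RealInnerProductSpace

theorem stmt_6 {E : Type*} [NormedAddCommGroup E] [InnerProductSpace ℝ E]
    (f : E → ℝ) (μ : ℝ) (hμ : 0 < μ) (xstar : E)
    (lam : ℕ → ℝ) (hlam1 : ∀ k, 1 ≤ lam k)
    (hlamrec : ∀ k : ℕ, 1 ≤ k → lam (k - 1) ^ 2 = lam k * (lam k - 1))
    (x y : ℕ → E) (eps : ℕ → ℝ) (heps : ∀ k, 0 ≤ eps k)
    (hsub : ∀ k : ℕ, ∀ z : E,
      f z ≥ f (y (k + 1)) + μ * ⟪x k - y (k + 1), z - y (k + 1)⟫ - eps k)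
    (hupd : ∀ k : ℕ,
      x (k + 1) = y (k + 1) + ((lam k - 1) / lam (k + 1)) • (y (k + 1) - y k)) :
    ∀ k : ℕ, 1 ≤ k →
      lam (k - 1) ^ 2 * (f (y k) - f xstar) - lam k ^ 2 * (f (y (k + 1)) - f xstar) ≥
        μ / 2 * ‖lam (k + 1) • (x (k + 1) - y (k + 1)) + y (k + 1) - xstar‖ ^ 2 -
          μ / 2 * ‖lam k • (x k - y k) + y k - xstar‖ ^ 2 - lam k ^ 2 * eps k := by
  intro k hk
  have hl : 1 ≤ lam k := hlam1 k
  have hne : lam (k + 1) ≠ 0 := (zero_lt_one.trans_le (hlam1 (k + 1))).ne'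
  set d := x k - y (k + 1) with hd
  set w := (lam k - 1) • (y (k + 1) - y k) + (y (k + 1) - xstar) with hw
  have hnext : lam (k + 1) • (x (k + 1) - y (k + 1)) + y (k + 1) - xstar = w := by
    rw [hupd k, add_sub_cancel_left, smul_smul, mul_div_cancel₀ _ hne, hw, add_sub_assoc]
  have hcurr : lam k • (x k - y k) + y k - xstar = w + lam k • d := by
    rw [hw, hd]; module
  have hnorm : ‖w + lam k • d‖ ^ 2 = ‖w‖ ^ 2 + 2 * (lam k * ⟪d, w⟫) + lam k ^ 2 * ‖d‖ ^ 2 := by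
    rw [norm_add_sq_real, real_inner_smul_right, real_inner_comm, norm_smul, mul_pow,
      Real.norm_eq_abs, sq_abs]
  have hinner : ⟪d, w⟫ = -((lam k - 1) * ⟪d, y k - y (k + 1)⟫) - ⟪d, xstar - y (k + 1)⟫ := by
    rw [hw, inner_add_right, real_inner_smul_right, ← neg_sub (y k), ← neg_sub xstar,
      inner_neg_right, inner_neg_right]
    ring
  have hy := mul_le_mul_of_nonneg_left (hsub k (y k))
    (mul_nonneg (by linarith) (by linarith) : 0 ≤ lam k * (lam k - 1))
  have hstar := mul_le_mul_of_nonneg_left (hsub k xstar) (by linarith : 0 ≤ lam k)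
  have hsq : 0 ≤ μ / 2 * (lam k ^ 2 * ‖d‖ ^ 2) := by positivity
  rw [hnext, hcurr, hnorm, hinner, hlamrec k hk]
  linarith
end

section
/- Let E be a real inner product space, f : E → ℝ, μ > 0, and x* ∈ E. Let (λ_k)_{k ≥ 0} be real numbers with λ_k ≥ 1 for all k and λ_{k−1}² = λ_k(λ_k − 1) for all k ≥ 1. Let (x_k), (y_k) be sequences in E and (ε_k) nonnegative reals satisfying: (i) for every k ≥ 0 and every z ∈ E, f(z) ≥ f(y_{k+1}) + μ⟨x_k − y_{k+1}, z − y_{k+1}⟩ − ε_k; (ii) the FPBA2 update x_{k+1} = y_{k+1} + ((λ_k − 1)/λ_{k+1})(y_{k+1} − y_k) + (λ_k/λ_{k+1})(y_{k+1} − x_k) for all k ≥ 0. Set δ_k = f(y_k) − f(x*) and w_k = λ_k(x_k − y_k) + y_k − x*. Then for every k ≥ 1, λ_{k−1}² δ_k − λ_k² δ_{k+1} ≥ (μ/4)‖w_{k+1}‖² − (μ/4)‖w_k‖² − λ_k² ε_k. -/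
open RealInnerProductSpace

theorem stmt_7 {E : Type*} [NormedAddCommGroup E] [InnerProductSpace ℝ E]
    (f : E → ℝ) (μ : ℝ) (hμ : 0 < μ) (xstar : E)
    (lam : ℕ → ℝ) (hlam1 : ∀ k, 1 ≤ lam k)
    (hlamrec : ∀ k : ℕ, 1 ≤ k → lam (k - 1) ^ 2 = lam k * (lam k - 1))
    (x y : ℕ → E) (eps : ℕ → ℝ) (heps : ∀ k, 0 ≤ eps k)
    (hsub : ∀ k : ℕ, ∀ z : E,
      f z ≥ f (y (k + 1)) + μ * ⟪x k - y (k + 1), z - y (k + 1)⟫ - eps k)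
    (hupd : ∀ k : ℕ,
      x (k + 1) = y (k + 1) + ((lam k - 1) / lam (k + 1)) • (y (k + 1) - y k) +
        (lam k / lam (k + 1)) • (y (k + 1) - x k)) :
    ∀ k : ℕ, 1 ≤ k →
      lam (k - 1) ^ 2 * (f (y k) - f xstar) - lam k ^ 2 * (f (y (k + 1)) - f xstar) ≥
        μ / 4 * ‖lam (k + 1) • (x (k + 1) - y (k + 1)) + y (k + 1) - xstar‖ ^ 2 -
          μ / 4 * ‖lam k • (x k - y k) + y k - xstar‖ ^ 2 - lam k ^ 2 * eps k := by
  intro k hk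
  have hL : 0 < lam k := by linarith [hlam1 k]
  have hL' : lam (k + 1) ≠ 0 := by linarith [hlam1 (k + 1)]
  have hw : lam (k + 1) • (x (k + 1) - y (k + 1)) + y (k + 1) - xstar =
      (lam k • (x k - y k) + y k - xstar) - (2 * lam k) • (x k - y (k + 1)) := by
    rw [hupd k, add_assoc, add_sub_cancel_left, smul_add, smul_smul, smul_smul,
      mul_div_cancel₀ _ hL', mul_div_cancel₀ _ hL']
    module
  have hv : lam k • (x k - y k) + y k - xstar =
      lam k • (x k - y (k + 1)) - ((lam k - 1) • (y k - y (k + 1)) + (xstar - y (k + 1))) := by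
    module
  have hnorm : ‖lam (k + 1) • (x (k + 1) - y (k + 1)) + y (k + 1) - xstar‖ ^ 2 -
      ‖lam k • (x k - y k) + y k - xstar‖ ^ 2 =
      4 * lam k * ((lam k - 1) * ⟪x k - y (k + 1), y k - y (k + 1)⟫ +
        ⟪x k - y (k + 1), xstar - y (k + 1)⟫) := by
    rw [hw, norm_sub_sq_real, norm_smul, mul_pow, Real.norm_eq_abs, sq_abs, inner_smul_right, hv,
      inner_sub_left, inner_add_left, real_inner_smul_left, real_inner_smul_left,
      real_inner_self_eq_norm_sq, real_inner_comm (x k - y (k + 1)) (y k - y (k + 1)),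
      real_inner_comm (x k - y (k + 1)) (xstar - y (k + 1))]
    ring
  have hy := mul_le_mul_of_nonneg_left (hsub k (y k))
    (mul_nonneg hL.le (sub_nonneg.2 (hlam1 k)))
  have hstar := mul_le_mul_of_nonneg_left (hsub k xstar) hL.le
  rw [hlamrec k hk]
  linear_combination hy + hstar + μ / 4 * hnorm
end

section
/- Let E be a real inner product space, f : E → ℝ, μ > 0, and let x* ∈ E be a global minimizer of f with f* = f(x*). Let (λ_k) be the Nesterov sequence λ_0 = 1, λ_{k+1} = (1 + √(1 + 4 λ_k²))/2. Let (x_k), (y_k) be sequences in E with y_0 = x_0 and (ε_k) nonnegative reals satisfying: (i) for every k ≥ 0 and every z ∈ E, f(z) ≥ f(y_{k+1}) + μ⟨x_k − y_{k+1}, z − y_{k+1}⟩ − ε_k; (ii) x_{k+1} = y_{k+1} + ((λ_k − 1)/λ_{k+1})(y_{k+1} − y_k) for all k ≥ 0. Then for every k ≥ 1, with R = ‖x_0 − x*‖, f(y_k) − f* ≤ 2μR²/(k+1)² + (1/λ_{k−1}²) Σ_{i=0}^{k−1} λ_i² ε_i. -/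
open RealInnerProductSpace

/-- One step of an accelerated inexact proximal method decreases the Lyapunov function, up to the
weighted tolerance `a ^ 2 * ε`. -/
theorem lyapunov_step_of_approx_subgradient {E : Type*} [NormedAddCommGroup E]
    [InnerProductSpace ℝ E] {f : E → ℝ} {μ ε a : ℝ} (hμ : 0 ≤ μ) (ha : 1 ≤ a) {x y p : E} (z : E)
    (hsub : ∀ w : E, f w ≥ f p + μ * ⟪x - p, w - p⟫ - ε) :
    a ^ 2 * (f p - f z) + μ / 2 * ‖a • p - (a - 1) • y - z‖ ^ 2 ≤
      (a ^ 2 - a) * (f y - f z) + μ / 2 * ‖a • x - (a - 1) • y - z‖ ^ 2 + a ^ 2 * ε := by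
  have hy := mul_le_mul_of_nonneg_left (hsub y) (by nlinarith : 0 ≤ a ^ 2 - a)
  have hz := mul_le_mul_of_nonneg_left (hsub z) (by linarith : 0 ≤ a)
  have hu : a • x - (a - 1) • y - z = (a • p - (a - 1) • y - z) + a • (x - p) := by module
  have hv : a • p - (a - 1) • y - z = -((a - 1) • (y - p) + (z - p)) := by module
  have hcross : ⟪a • p - (a - 1) • y - z, a • (x - p)⟫ =
      -(a * ((a - 1) * ⟪x - p, y - p⟫ + ⟪x - p, z - p⟫)) := by
    rw [hv, inner_neg_left, inner_add_left, real_inner_smul_left, real_inner_smul_right,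
      real_inner_smul_right, real_inner_comm (x - p) (y - p), real_inner_comm (x - p) (z - p)]
    ring
  have hnorm := norm_add_sq_real (a • p - (a - 1) • y - z) (a • (x - p))
  rw [← hu, hcross] at hnorm
  rw [hnorm]
  have hsq : 0 ≤ μ / 2 * ‖a • (x - p)‖ ^ 2 := by positivity
  linarith

/-- The Nesterov sequence grows at least linearly with slope `1 / 2`. -/
theorem nesterov_seq_lower_bound {lam : ℕ → ℝ} (h0 : lam 0 = 1)
    (hrec : ∀ k : ℕ, lam (k + 1) = (1 + Real.sqrt (1 + 4 * lam k ^ 2)) / 2) (n : ℕ) :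
    ((n : ℝ) + 2) / 2 ≤ lam n := by
  induction n with
  | zero => simp [h0]
  | succ n ih =>
    have hsqrt : 2 * lam n ≤ Real.sqrt (1 + 4 * lam n ^ 2) :=
      Real.le_sqrt_of_sq_le (by linarith [mul_pow 2 (lam n) 2])
    rw [hrec]
    push_cast
    linarith

/-- The defining quadratic equation of the Nesterov sequence. -/
theorem nesterov_seq_sq_sub_self {lam : ℕ → ℝ}
    (hrec : ∀ k : ℕ, lam (k + 1) = (1 + Real.sqrt (1 + 4 * lam k ^ 2)) / 2) (n : ℕ) :
    lam (n + 1) ^ 2 - lam (n + 1) = lam n ^ 2 := by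
  rw [hrec]
  linarith [Real.sq_sqrt (by positivity : 0 ≤ 1 + 4 * lam n ^ 2)]

theorem stmt_8 {E : Type*} [NormedAddCommGroup E] [InnerProductSpace ℝ E]
    (f : E → ℝ) (μ : ℝ) (hμ : 0 < μ) (xstar : E) (hstar : ∀ z, f xstar ≤ f z)
    (lam : ℕ → ℝ) (h0 : lam 0 = 1)
    (hrec : ∀ k : ℕ, lam (k + 1) = (1 + Real.sqrt (1 + 4 * lam k ^ 2)) / 2)
    (x y : ℕ → E) (hinit : y 0 = x 0) (eps : ℕ → ℝ) (heps : ∀ k, 0 ≤ eps k)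
    (hsub : ∀ k : ℕ, ∀ z : E,
      f z ≥ f (y (k + 1)) + μ * ⟪x k - y (k + 1), z - y (k + 1)⟫ - eps k)
    (hupd : ∀ k : ℕ,
      x (k + 1) = y (k + 1) + ((lam k - 1) / lam (k + 1)) • (y (k + 1) - y k)) :
    ∀ k : ℕ, 1 ≤ k →
      f (y k) - f xstar ≤ 2 * μ * ‖x 0 - xstar‖ ^ 2 / ((k : ℝ) + 1) ^ 2 +
        (1 / lam (k - 1) ^ 2) * ∑ i ∈ Finset.range k, lam i ^ 2 * eps i := by
  have hlow := nesterov_seq_lower_bound h0 hrec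
  have hone (n : ℕ) : 1 ≤ lam n := by linarith [hlow n, n.cast_nonneg (α := ℝ)]
  have hstep (n : ℕ) :=
    lyapunov_step_of_approx_subgradient (y := y n) hμ.le (hone n) xstar (hsub n)
  have hlyap (n : ℕ) : lam n ^ 2 * (f (y (n + 1)) - f xstar) +
      μ / 2 * ‖lam n • y (n + 1) - (lam n - 1) • y n - xstar‖ ^ 2 ≤
      μ / 2 * ‖x 0 - xstar‖ ^ 2 + ∑ i ∈ Finset.range (n + 1), lam i ^ 2 * eps i := by
    induction n with
    | zero => simpa [h0] using hstep 0
    | succ n ih =>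
      have hpos : lam (n + 1) ≠ 0 := by linarith [hone (n + 1)]
      have hu : lam (n + 1) • x (n + 1) - (lam (n + 1) - 1) • y (n + 1) - xstar =
          lam n • y (n + 1) - (lam n - 1) • y n - xstar := by
        rw [hupd, smul_add, smul_smul, mul_div_cancel₀ _ hpos]
        module
      have h := hstep (n + 1)
      rw [hu, nesterov_seq_sq_sub_self hrec] at h
      rw [Finset.sum_range_succ]
      linarith
  rintro (_ | n) hk
  · omega
  have hn : 0 < lam n := by linarith [hone n]
  have hgap : f (y (n + 1)) - f xstar ≤ (μ / 2 * ‖x 0 - xstar‖ ^ 2 +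
      ∑ i ∈ Finset.range (n + 1), lam i ^ 2 * eps i) / lam n ^ 2 := by
    rw [le_div_iff₀' (by positivity)]
    exact (le_add_of_nonneg_right (by positivity)).trans (hlyap n)
  have hrate : μ / 2 * ‖x 0 - xstar‖ ^ 2 / lam n ^ 2 ≤
      2 * μ * ‖x 0 - xstar‖ ^ 2 / (((n + 1 : ℕ) : ℝ) + 1) ^ 2 := by
    calc _ ≤ μ / 2 * ‖x 0 - xstar‖ ^ 2 / (((n : ℝ) + 2) / 2) ^ 2 := by gcongr; exact hlow n
      _ = _ := by push_cast; field_simp; ring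
  rw [add_div] at hgap
  rw [Nat.add_sub_cancel, one_div_mul_eq_div]
  linarith
end

section
/- Let E be a real inner product space, f : E → ℝ, μ > 0, and let x* ∈ E be a global minimizer of f with f* = f(x*). Let (λ_k) be the Nesterov sequence λ_0 = 1, λ_{k+1} = (1 + √(1 + 4 λ_k²))/2. Let (x_k), (y_k) be sequences in E with y_0 = x_0 and (ε_k) nonnegative reals satisfying: (i) for every k ≥ 0 and every z ∈ E, f(z) ≥ f(y_{k+1}) + μ⟨x_k − y_{k+1}, z − y_{k+1}⟩ − ε_k; (ii) x_{k+1} = y_{k+1} + ((λ_k − 1)/λ_{k+1})(y_{k+1} − y_k) + (λ_k/λ_{k+1})(y_{k+1} − x_k) for all k ≥ 0. Then for every k ≥ 1, with R = ‖x_0 − x*‖, f(y_k) − f* ≤ μR²/(k+1)² + (1/λ_{k−1}²) Σ_{i=0}^{k−1} λ_i² ε_i. -/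
open RealInnerProductSpace

/-- Terms of the Nesterov sequence satisfy `lam (k + 1) ^ 2 - lam (k + 1) = lam k ^ 2`. -/
theorem nesterov_sq_sub {lam : ℕ → ℝ}
    (hrec : ∀ k : ℕ, lam (k + 1) = (1 + Real.sqrt (1 + 4 * lam k ^ 2)) / 2) (k : ℕ) :
    lam (k + 1) ^ 2 - lam (k + 1) = lam k ^ 2 := by
  have h := Real.sq_sqrt (show (0 : ℝ) ≤ 1 + 4 * lam k ^ 2 by positivity)
  rw [hrec k]
  linear_combination h / 4

/-- The Nesterov sequence grows at least linearly. -/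
theorem nesterov_lower_bound {lam : ℕ → ℝ} (h0 : lam 0 = 1)
    (hrec : ∀ k : ℕ, lam (k + 1) = (1 + Real.sqrt (1 + 4 * lam k ^ 2)) / 2) (k : ℕ) :
    ((k : ℝ) + 2) / 2 ≤ lam k := by
  induction k with
  | zero => simp [h0]
  | succ k ih =>
    have h : 2 * lam k ≤ Real.sqrt (1 + 4 * lam k ^ 2) :=
      Real.le_sqrt_of_sq_le (by linarith [mul_pow 2 (lam k) 2])
    rw [hrec k]
    push_cast
    linarith

/-- The identity behind the decrease of the Lyapunov function: reflecting `v` to `v - 2 p`. -/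
theorem norm_sub_two_smul_sq {E : Type*} [NormedAddCommGroup E] [InnerProductSpace ℝ E]
    (v p : E) : ‖v - (2 : ℝ) • p‖ ^ 2 = ‖v‖ ^ 2 - 4 * ⟪p, v - p⟫ := by
  rw [norm_sub_sq_real, norm_smul, inner_smul_right, inner_sub_right, real_inner_self_eq_norm_sq,
    real_inner_comm, mul_pow, Real.norm_eq_abs, sq_abs]
  ring

/-- One step of the extrapolated inexact proximal point method decreases the Lyapunov function
up to the error of the step. Here `l`, `l'` are consecutive weights, `u` is the proximal center,
`w` the previous iterate, `w'` the new iterate and `u'` the new center. -/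
theorem lyapunov_step {E : Type*} [NormedAddCommGroup E] [InnerProductSpace ℝ E]
    {f : E → ℝ} {μ l l' e : ℝ} {s u u' w w' : E} (hl : 1 ≤ l) (hl' : l' ≠ 0)
    (hsub : ∀ z, f z ≥ f w' + μ * ⟪u - w', z - w'⟫ - e)
    (hupd : u' = w' + ((l - 1) / l') • (w' - w) + (l / l') • (w' - u)) :
    l ^ 2 * (f w' - f s) + μ / 4 * ‖l' • u' - (l' - 1) • w' - s‖ ^ 2 ≤
      (l ^ 2 - l) * (f w - f s) + μ / 4 * ‖l • u - (l - 1) • w - s‖ ^ 2 + l ^ 2 * e := by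
  have hv : l' • u' - (l' - 1) • w' - s =
      (l • u - (l - 1) • w - s) - (2 : ℝ) • (l • (u - w')) := by
    have h : l' • u' = l' • w' + (l - 1) • (w' - w) + l • (w' - u) := by
      rw [hupd, smul_add, smul_add, smul_smul, smul_smul, mul_div_cancel₀ _ hl',
        mul_div_cancel₀ _ hl']
    rw [h]
    module
  have hp : (l • u - (l - 1) • w - s) - l • (u - w') =
      -((l - 1) • (w - w') + (s - w')) := by module
  rw [hv, norm_sub_two_smul_sq, hp, inner_neg_right, inner_add_right, inner_smul_right,
    real_inner_smul_left, real_inner_smul_left]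
  have hw := mul_le_mul_of_nonneg_left (hsub w)
    (mul_nonneg (by linarith : (0 : ℝ) ≤ l) (sub_nonneg.2 hl))
  have hs := mul_le_mul_of_nonneg_left (hsub s) (by linarith : (0 : ℝ) ≤ l)
  linarith

theorem stmt_9 {E : Type*} [NormedAddCommGroup E] [InnerProductSpace ℝ E]
    (f : E → ℝ) (μ : ℝ) (hμ : 0 < μ) (xstar : E) (hstar : ∀ z, f xstar ≤ f z)
    (lam : ℕ → ℝ) (h0 : lam 0 = 1)
    (hrec : ∀ k : ℕ, lam (k + 1) = (1 + Real.sqrt (1 + 4 * lam k ^ 2)) / 2)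
    (x y : ℕ → E) (hinit : y 0 = x 0) (eps : ℕ → ℝ) (heps : ∀ k, 0 ≤ eps k)
    (hsub : ∀ k : ℕ, ∀ z : E,
      f z ≥ f (y (k + 1)) + μ * ⟪x k - y (k + 1), z - y (k + 1)⟫ - eps k)
    (hupd : ∀ k : ℕ,
      x (k + 1) = y (k + 1) + ((lam k - 1) / lam (k + 1)) • (y (k + 1) - y k) +
        (lam k / lam (k + 1)) • (y (k + 1) - x k)) :
    ∀ k : ℕ, 1 ≤ k →
      f (y k) - f xstar ≤ μ * ‖x 0 - xstar‖ ^ 2 / ((k : ℝ) + 1) ^ 2 +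
        (1 / lam (k - 1) ^ 2) * ∑ i ∈ Finset.range k, lam i ^ 2 * eps i := by
  have hlam := nesterov_lower_bound h0 hrec
  have hone : ∀ k, 1 ≤ lam k := fun k => by
    linarith [hlam k, (Nat.cast_nonneg k : (0 : ℝ) ≤ k)]
  have hlyap : ∀ k, (lam k ^ 2 - lam k) * (f (y k) - f xstar) +
      μ / 4 * ‖lam k • x k - (lam k - 1) • y k - xstar‖ ^ 2 ≤
      μ / 4 * ‖x 0 - xstar‖ ^ 2 + ∑ i ∈ Finset.range k, lam i ^ 2 * eps i := by
    intro k
    induction k with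
    | zero => simp [h0]
    | succ k ih =>
      rw [nesterov_sq_sub hrec k, Finset.sum_range_succ]
      linarith [lyapunov_step (s := xstar) (hone k) (by linarith [hone (k + 1)] : lam (k + 1) ≠ 0)
        (hsub k) (hupd k)]
  rintro (_ | k) hk
  · omega
  have hpos : 0 < lam k := by linarith [hone k]
  have hmain : lam k ^ 2 * (f (y (k + 1)) - f xstar) ≤
      μ / 4 * ‖x 0 - xstar‖ ^ 2 + ∑ i ∈ Finset.range (k + 1), lam i ^ 2 * eps i := by
    have h := hlyap (k + 1)
    rw [nesterov_sq_sub hrec k] at h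
    exact (le_add_of_nonneg_right (by positivity)).trans h
  have hrate : μ / 4 * ‖x 0 - xstar‖ ^ 2 / lam k ^ 2 ≤
      μ * ‖x 0 - xstar‖ ^ 2 / (((k + 1 : ℕ) : ℝ) + 1) ^ 2 := by
    calc μ / 4 * ‖x 0 - xstar‖ ^ 2 / lam k ^ 2
        ≤ μ / 4 * ‖x 0 - xstar‖ ^ 2 / (((k : ℝ) + 2) / 2) ^ 2 := by
          gcongr
          exact hlam k
      _ = μ * ‖x 0 - xstar‖ ^ 2 / (((k + 1 : ℕ) : ℝ) + 1) ^ 2 := by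
          push_cast
          field_simp
          ring
  rw [Nat.add_sub_cancel]
  calc f (y (k + 1)) - f xstar
      ≤ (μ / 4 * ‖x 0 - xstar‖ ^ 2 + ∑ i ∈ Finset.range (k + 1), lam i ^ 2 * eps i) /
          lam k ^ 2 := by
        rw [le_div_iff₀ (by positivity), mul_comm]
        exact hmain
    _ = μ / 4 * ‖x 0 - xstar‖ ^ 2 / lam k ^ 2 +
          (1 / lam k ^ 2) * ∑ i ∈ Finset.range (k + 1), lam i ^ 2 * eps i := by ring
    _ ≤ _ := by gcongr
end

section
/- Let E be a real inner product space, f : E → ℝ, μ > 0, and let x* ∈ E be a global minimizer of f with f* = f(x*). Let (λ_k)_{k ≥ 0} be real numbers with λ_0 = 1, λ_k ≥ 1 for all k, and λ_k² − λ_{k−1}² ≤ λ_k for all k ≥ 1. Let (x_k), (y_k) be sequences in E with y_0 = x_0 and (ε_k) nonnegative reals satisfying: (i) for every k ≥ 0 and every z ∈ E, f(z) ≥ f(y_{k+1}) + μ⟨x_k − y_{k+1}, z − y_{k+1}⟩ − ε_k; (ii) x_{k+1} = y_{k+1} + ((λ_k − 1)/λ_{k+1})(y_{k+1} − y_k) for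 all k ≥ 0. Then for every k ≥ 1, λ_{k−1}² (f(y_k) − f*) ≤ (μ/2)‖x_0 − x*‖² + Σ_{i=0}^{k−1} λ_i² ε_i. -/
open RealInnerProductSpace

/-- One step of an inexact accelerated proximal scheme: the weighted sum of the approximate
subgradient inequalities at `b` (weight `l * (l - 1)`) and at `s` (weight `l`). -/
lemma accelerated_prox_step {E : Type*} [NormedAddCommGroup E] [InnerProductSpace ℝ E]
    {f : E → ℝ} {μ l e : ℝ} (hμ : 0 ≤ μ) (hl : 1 ≤ l) {a b c s : E}
    (hsub : ∀ z : E, f z ≥ f c + μ * ⟪a - c, z - c⟫ - e) :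
    l ^ 2 * (f c - f s) + μ / 2 * ‖l • c - (l - 1) • b - s‖ ^ 2 ≤
      (l ^ 2 - l) * (f b - f s) + μ / 2 * ‖l • a - (l - 1) • b - s‖ ^ 2 + l ^ 2 * e := by
  have hb := mul_le_mul_of_nonneg_left (hsub b) (show 0 ≤ l * (l - 1) by nlinarith)
  have hs := mul_le_mul_of_nonneg_left (hsub s) (show 0 ≤ l by linarith)
  have hinner : ‖l • a - (l - 1) • b - s‖ ^ 2 =
      ‖l • c - (l - 1) • b - s‖ ^ 2 + ‖l • (a - c)‖ ^ 2 -
        2 * (l * (l - 1) * ⟪a - c, b - c⟫ + l * ⟪a - c, s - c⟫) := by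
    have hu : l • a - (l - 1) • b - s = (l • c - (l - 1) • b - s) + l • (a - c) := by module
    have hw : l • c - (l - 1) • b - s = -((l - 1) • (b - c) + (s - c)) := by module
    rw [hu, norm_add_sq_real, real_inner_comm]
    nth_rewrite 2 [hw]
    rw [inner_neg_right, inner_add_right, inner_smul_right, real_inner_smul_left,
      real_inner_smul_left]
    ring
  have hsq : 0 ≤ μ / 2 * ‖l • (a - c)‖ ^ 2 := by positivity
  rw [hinner]
  linarith

theorem stmt_11 {E : Type*} [NormedAddCommGroup E] [InnerProductSpace ℝ E]
    (f : E → ℝ) (μ : ℝ) (hμ : 0 < μ) (xstar : E) (hstar : ∀ z, f xstar ≤ f z)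
    (lam : ℕ → ℝ) (h0 : lam 0 = 1) (hlam1 : ∀ k, 1 ≤ lam k)
    (hlamrec : ∀ k : ℕ, 1 ≤ k → lam k ^ 2 - lam (k - 1) ^ 2 ≤ lam k)
    (x y : ℕ → E) (hinit : y 0 = x 0) (eps : ℕ → ℝ) (heps : ∀ k, 0 ≤ eps k)
    (hsub : ∀ k : ℕ, ∀ z : E,
      f z ≥ f (y (k + 1)) + μ * ⟪x k - y (k + 1), z - y (k + 1)⟫ - eps k)
    (hupd : ∀ k : ℕ,
      x (k + 1) = y (k + 1) + ((lam k - 1) / lam (k + 1)) • (y (k + 1) - y k)) :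
    ∀ k : ℕ, 1 ≤ k →
      lam (k - 1) ^ 2 * (f (y k) - f xstar) ≤
        μ / 2 * ‖x 0 - xstar‖ ^ 2 + ∑ i ∈ Finset.range k, lam i ^ 2 * eps i := by
  have potential : ∀ k : ℕ,
      lam k ^ 2 * (f (y (k + 1)) - f xstar) +
          μ / 2 * ‖lam k • y (k + 1) - (lam k - 1) • y k - xstar‖ ^ 2 ≤
        μ / 2 * ‖x 0 - xstar‖ ^ 2 + ∑ i ∈ Finset.range (k + 1), lam i ^ 2 * eps i := by
    intro k
    induction k with
    | zero =>
      have h := accelerated_prox_step (b := y 0) (s := xstar) hμ.le (hlam1 0) (hsub 0)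
      simpa [h0] using h
    | succ k ih =>
      have h := accelerated_prox_step (b := y (k + 1)) (s := xstar) hμ.le (hlam1 (k + 1))
        (hsub (k + 1))
      have hne : lam (k + 1) ≠ 0 := by linarith [hlam1 (k + 1)]
      have hu : lam (k + 1) • x (k + 1) - (lam (k + 1) - 1) • y (k + 1) - xstar =
          lam k • y (k + 1) - (lam k - 1) • y k - xstar := by
        rw [hupd k, smul_add, smul_smul, mul_div_cancel₀ _ hne]
        module
      rw [hu] at h
      have hrec := hlamrec (k + 1) (Nat.le_add_left 1 k)
      rw [Nat.add_sub_cancel] at hrec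
      have hv := mul_le_mul_of_nonneg_right
        (show lam (k + 1) ^ 2 - lam (k + 1) ≤ lam k ^ 2 by linarith)
        (sub_nonneg.2 (hstar (y (k + 1))))
      rw [Finset.sum_range_succ]
      linarith
  rintro (_ | k) hk
  · omega
  · have hnonneg : 0 ≤ μ / 2 * ‖lam k • y (k + 1) - (lam k - 1) • y k - xstar‖ ^ 2 := by
      positivity
    rw [Nat.add_sub_cancel]
    linarith [potential k]
end

section
/- Let (λ_k) be the Nesterov sequence λ_0 = 1, λ_{k+1} = (1 + √(1 + 4 λ_k²))/2, and for k ≥ 1 define θ_k = (1/λ_{k−1}²) Σ_{i=0}^{k−1} λ_i². Then θ_1 = 1, θ_{k+1} = 1 + (1 − 1/λ_k) θ_k for all k ≥ 1, θ_k ≤ λ_k for all k ≥ 1, and the sequence (θ_k)_{k ≥ 1} is nondecreasing: θ_{k+1} ≥ θ_k for all k ≥ 1. -/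
theorem nesterov_sq_sub_self {x y : ℝ} (h : y = (1 + Real.sqrt (1 + 4 * x ^ 2)) / 2) :
    y ^ 2 - y = x ^ 2 := by
  have hs : Real.sqrt (1 + 4 * x ^ 2) ^ 2 = 1 + 4 * x ^ 2 := Real.sq_sqrt (by positivity)
  rw [h]
  linear_combination hs / 4

theorem one_le_nesterov_step {x y : ℝ} (h : y = (1 + Real.sqrt (1 + 4 * x ^ 2)) / 2) :
    1 ≤ y := by
  have hs : 1 ≤ Real.sqrt (1 + 4 * x ^ 2) := Real.one_le_sqrt.mpr (by nlinarith [sq_nonneg x])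
  linarith

theorem le_nesterov_step {x y : ℝ} (h : y = (1 + Real.sqrt (1 + 4 * x ^ 2)) / 2) :
    x ≤ y := by
  have hy := one_le_nesterov_step h
  have hxy := nesterov_sq_sub_self h
  exact le_of_sq_le_sq (by linarith) (by linarith)

theorem stmt_12 (lam : ℕ → ℝ) (h0 : lam 0 = 1)
    (hrec : ∀ k : ℕ, lam (k + 1) = (1 + Real.sqrt (1 + 4 * lam k ^ 2)) / 2)
    (theta : ℕ → ℝ)
    (htheta : ∀ k : ℕ, 1 ≤ k →
      theta k = (1 / lam (k - 1) ^ 2) * ∑ i ∈ Finset.range k, lam i ^ 2) :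
    theta 1 = 1 ∧
    (∀ k : ℕ, 1 ≤ k → theta (k + 1) = 1 + (1 - 1 / lam k) * theta k) ∧
    (∀ k : ℕ, 1 ≤ k → theta k ≤ lam k) ∧
    (∀ k : ℕ, 1 ≤ k → theta k ≤ theta (k + 1)) := by
  have one_le : ∀ k, 1 ≤ lam k
    | 0 => h0.ge
    | k + 1 => one_le_nesterov_step (hrec k)
  have pos (k : ℕ) : 0 < lam k := one_pos.trans_le (one_le k)
  have theta_one : theta 1 = 1 := by simp [htheta 1 le_rfl, h0]
  have theta_succ (k : ℕ) (hk : 1 ≤ k) :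
      theta (k + 1) = 1 + (1 - 1 / lam k) * theta k := by
    obtain ⟨j, rfl⟩ := Nat.exists_eq_add_of_le' hk
    have hj := (pos j).ne'
    have hj' := (pos (j + 1)).ne'
    have hsq := nesterov_sq_sub_self (hrec j)
    rw [htheta (j + 1 + 1) (by omega), htheta (j + 1) hk, Finset.sum_range_succ _ (j + 1)]
    simp only [Nat.add_sub_cancel]
    generalize ∑ i ∈ Finset.range (j + 1), lam i ^ 2 = S
    field_simp
    linear_combination (-S) * hsq
  have theta_le (k : ℕ) (hk : 1 ≤ k) : theta k ≤ lam k := by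
    induction k, hk using Nat.le_induction with
    | base => exact theta_one.trans_le (one_le 1)
    | succ k hk ih =>
      have hcoef : 0 ≤ 1 - 1 / lam k :=
        sub_nonneg.mpr ((div_le_one (pos k)).mpr (one_le k))
      calc theta (k + 1) = 1 + (1 - 1 / lam k) * theta k := theta_succ k hk
        _ ≤ 1 + (1 - 1 / lam k) * lam k := by gcongr
        _ = lam k := by
          have := (pos k).ne'
          field_simp
          ring
        _ ≤ lam (k + 1) := le_nesterov_step (hrec k)
  refine ⟨theta_one, theta_succ, theta_le, fun k hk => ?_⟩
  have hdiv : theta k / lam k ≤ 1 := (div_le_one (pos k)).mpr (theta_le k hk)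
  rw [theta_succ k hk]
  linear_combination hdiv
end
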